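/- Let E be a real inner product space, S ⊆ E, h > 0, α ≥ 0, B ≥ 0, r ≥ 0, and n ≥ 1. Let x, x' : Fin n → E be two families of points and c, c' : Fin n → ℝ positive constants such that there is an index j with x(i) = x'(i) and c(i) = c'(i) for all i ≠ j, ‖x(j) − x'(j)‖ ≤ α, |log c(j) − log c'(j)| ≤ r, and ‖s − x(j)‖ ≤ B for all s ∈ S. Then for every s ∈ S, ∑_{i} exp(−‖s − x(i)‖²/(2h²))/c(i) ≤ exp( (2αB + α²)/(2h²) + r ) · ∑_{i} exp(−‖s − x'(i)‖²/(2h²))/c'(i). -/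

import Mathlib

open Finset

/-- Moving the centre of a Gaussian kernel by at most `α`, at a point within distance `B` of the
original centre, and changing the log of the normalization by at most `r`, changes the normalized
kernel by at most the factor `exp ((2αB + α²) / (2h²) + r)`. -/
theorem gaussian_kernel_div_le {E : Type*} [SeminormedAddCommGroup E] {h α B r c c' : ℝ}
    {s x x' : E} (hα : 0 ≤ α) (hc : 0 < c) (hc' : 0 < c') (hmove : ‖x - x'‖ ≤ α)
    (hlog : |Real.log c - Real.log c'| ≤ r) (hs : ‖s - x‖ ≤ B) :
    Real.exp (-‖s - x‖ ^ 2 / (2 * h ^ 2)) / c ≤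
      Real.exp ((2 * α * B + α ^ 2) / (2 * h ^ 2) + r) *
        (Real.exp (-‖s - x'‖ ^ 2 / (2 * h ^ 2)) / c') := by
  have htri : ‖s - x'‖ ≤ ‖s - x‖ + α :=
    (norm_sub_le_norm_sub_add_norm_sub s x x').trans (by gcongr)
  have hsq : -‖s - x‖ ^ 2 ≤ 2 * α * B + α ^ 2 + -‖s - x'‖ ^ 2 := by
    have h₁ : ‖s - x'‖ ^ 2 ≤ (‖s - x‖ + α) ^ 2 := by gcongr
    have h₂ : α * ‖s - x‖ ≤ α * B := by gcongr
    linarith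
  have hdiv : -‖s - x‖ ^ 2 / (2 * h ^ 2) ≤
      (2 * α * B + α ^ 2) / (2 * h ^ 2) + -‖s - x'‖ ^ 2 / (2 * h ^ 2) := by
    rw [← add_div]
    gcongr
  have hlog' := (abs_le.mp hlog).1
  rw [← Real.exp_log hc, ← Real.exp_log hc', ← Real.exp_sub, ← Real.exp_sub, ← Real.exp_add]
  exact Real.exp_le_exp.mpr (by linarith)

/-- Deterministic core of the kernel Poisson point synthesizer theorem: for two
families of points differing only at index `j` (moved by at most `α`), with
positive edge-correction constants whose log-ratio at `j` is at most `r`, the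
edge-corrected Gaussian kernel intensity estimates satisfy the pointwise ratio
bound `λ_D(s) ≤ exp((2αB + α²)/(2h²) + r) · λ_{D'}(s)` on `S`. -/
theorem kernel_intensity_ratio_bound
    {E : Type*} [NormedAddCommGroup E] [InnerProductSpace ℝ E]
    (S : Set E) (h α B r : ℝ) (hh : 0 < h) (hα : 0 ≤ α) (hB : 0 ≤ B) (hr : 0 ≤ r)
    (n : ℕ) (hn : 1 ≤ n)
    (x x' : Fin n → E) (c c' : Fin n → ℝ)
    (hc : ∀ i, 0 < c i) (hc' : ∀ i, 0 < c' i)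
    (j : Fin n)
    (hsame : ∀ i, i ≠ j → x i = x' i ∧ c i = c' i)
    (hmove : ‖x j - x' j‖ ≤ α)
    (hlog : |Real.log (c j) - Real.log (c' j)| ≤ r)
    (hdiam : ∀ s ∈ S, ‖s - x j‖ ≤ B) :
    ∀ s ∈ S,
      ∑ i, Real.exp (-‖s - x i‖ ^ 2 / (2 * h ^ 2)) / c i ≤
        Real.exp ((2 * α * B + α ^ 2) / (2 * h ^ 2) + r) *
          ∑ i, Real.exp (-‖s - x' i‖ ^ 2 / (2 * h ^ 2)) / c' i := by
  intro s hs
  rw [Finset.mul_sum]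
  refine Finset.sum_le_sum fun i _ => ?_
  by_cases hij : i = j
  · subst hij
    exact gaussian_kernel_div_le hα (hc i) (hc' i) hmove hlog (hdiam s hs)
  · obtain ⟨hx, hci⟩ := hsame i hij
    rw [hx, hci]
    have hpos := hc' i
    exact le_mul_of_one_le_left (by positivity) (Real.one_le_exp (by positivity))
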